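/- Let a : ℝ → ℝ be smooth and 2π-periodic, let f : ℝ² → ℝ² be smooth and 2π-periodic in each variable with div f = 0 and ∫_{−π}^{π} f(x₁,x₂) dx₁ = 0 for every x₂, and let p_L : ℝ² → ℝ be smooth, 2π-periodic in each variable, with zero average over [−π,π]², satisfying −Δp_L = 2 ∂₂a ∂₁f₂. Define Lf := (1+a)² ∂₁²f + (1+a) ∇∂₁p_L − (∂₂a ∂₂p_L) e₁. Then div(Lf) = 0 everywhere, and ∫_{−π}^{π} (Lf)(x₁,x₂) dx₁ = 0 for every x₂. -/

import Mathlib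

open Real Filter MeasureTheory

/-- The partial derivative in the first variable. -/
noncomputable def partialFst (g : ℝ → ℝ → ℝ) : ℝ → ℝ → ℝ :=
  fun x y => deriv (fun t => g t y) x

/-- The partial derivative in the second variable. -/
noncomputable def partialSnd (g : ℝ → ℝ → ℝ) : ℝ → ℝ → ℝ :=
  fun x y => deriv (fun t => g x t) y

/-- Joint smoothness of a function of two real variables. -/
def SmoothTwo (g : ℝ → ℝ → ℝ) : Prop :=
  ContDiff ℝ (⊤ : ℕ∞) (fun q : ℝ × ℝ => g q.1 q.2)

namespace SmoothTwo

variable {g : ℝ → ℝ → ℝ}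

theorem hasFDerivAt (hg : SmoothTwo g) (q : ℝ × ℝ) :
    HasFDerivAt (fun q : ℝ × ℝ => g q.1 q.2) (fderiv ℝ (fun q : ℝ × ℝ => g q.1 q.2) q) q :=
  (ContDiff.differentiable hg (by simp) q).hasFDerivAt

theorem hasDerivAt_fst_fderiv (hg : SmoothTwo g) (x y : ℝ) :
    HasDerivAt (fun t => g t y) (fderiv ℝ (fun q : ℝ × ℝ => g q.1 q.2) (x, y) (1, 0)) x :=
  (hg.hasFDerivAt (x, y)).comp_hasDerivAt (f := fun t => (t, y)) x
    ((hasDerivAt_id x).prodMk (hasDerivAt_const x y))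

theorem hasDerivAt_snd_fderiv (hg : SmoothTwo g) (x y : ℝ) :
    HasDerivAt (fun t => g x t) (fderiv ℝ (fun q : ℝ × ℝ => g q.1 q.2) (x, y) (0, 1)) y :=
  (hg.hasFDerivAt (x, y)).comp_hasDerivAt (f := fun t => (x, t)) y
    ((hasDerivAt_const y x).prodMk (hasDerivAt_id y))

theorem partialFst_eq (hg : SmoothTwo g) (x y : ℝ) :
    partialFst g x y = fderiv ℝ (fun q : ℝ × ℝ => g q.1 q.2) (x, y) (1, 0) :=
  (hg.hasDerivAt_fst_fderiv x y).deriv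

theorem partialSnd_eq (hg : SmoothTwo g) (x y : ℝ) :
    partialSnd g x y = fderiv ℝ (fun q : ℝ × ℝ => g q.1 q.2) (x, y) (0, 1) :=
  (hg.hasDerivAt_snd_fderiv x y).deriv

theorem hasDerivAt_fst (hg : SmoothTwo g) (x y : ℝ) :
    HasDerivAt (fun t => g t y) (partialFst g x y) x :=
  (hg.hasDerivAt_fst_fderiv x y).differentiableAt.hasDerivAt

theorem hasDerivAt_snd (hg : SmoothTwo g) (x y : ℝ) :
    HasDerivAt (fun t => g x t) (partialSnd g x y) y :=
  (hg.hasDerivAt_snd_fderiv x y).differentiableAt.hasDerivAt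

theorem contDiff_fderiv (hg : SmoothTwo g) :
    ContDiff ℝ (⊤ : ℕ∞) (fderiv ℝ (fun q : ℝ × ℝ => g q.1 q.2)) :=
  ContDiff.fderiv_right hg (by simp)

theorem fst (hg : SmoothTwo g) : SmoothTwo (partialFst g) := by
  unfold SmoothTwo
  simp only [hg.partialFst_eq]
  exact hg.contDiff_fderiv.clm_apply contDiff_const

theorem snd (hg : SmoothTwo g) : SmoothTwo (partialSnd g) := by
  unfold SmoothTwo
  simp only [hg.partialSnd_eq]
  exact hg.contDiff_fderiv.clm_apply contDiff_const

theorem continuous (hg : SmoothTwo g) : Continuous (fun q : ℝ × ℝ => g q.1 q.2) :=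
  ContDiff.continuous hg

theorem intervalIntegrable_fst (hg : SmoothTwo g) (a b y : ℝ) :
    IntervalIntegrable (fun x => g x y) volume a b :=
  (hg.continuous.comp (by fun_prop : Continuous fun x : ℝ => (x, y))).intervalIntegrable a b

theorem intervalIntegrable_snd (hg : SmoothTwo g) (a b x : ℝ) :
    IntervalIntegrable (fun y => g x y) volume a b :=
  (hg.continuous.comp (by fun_prop : Continuous fun y : ℝ => (x, y))).intervalIntegrable a b

theorem partialSnd_partialFst (hg : SmoothTwo g) (x y : ℝ) :
    partialSnd (partialFst g) x y = partialFst (partialSnd g) x y := by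
  have hd : HasFDerivAt (fderiv ℝ (fun q : ℝ × ℝ => g q.1 q.2))
      (fderiv ℝ (fderiv ℝ (fun q : ℝ × ℝ => g q.1 q.2)) (x, y)) (x, y) :=
    (hg.contDiff_fderiv.differentiable (by simp) (x, y)).hasFDerivAt
  have hy : HasDerivAt (fun t => partialFst g x t)
      (fderiv ℝ (fderiv ℝ (fun q : ℝ × ℝ => g q.1 q.2)) (x, y) (0, 1) (1, 0)) y := by
    simp only [hg.partialFst_eq]
    have h := hd.comp_hasDerivAt y ((hasDerivAt_const y x).prodMk (hasDerivAt_id y))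
    simpa using h.clm_apply (hasDerivAt_const y ((1, 0) : ℝ × ℝ))
  have hx : HasDerivAt (fun t => partialSnd g t y)
      (fderiv ℝ (fderiv ℝ (fun q : ℝ × ℝ => g q.1 q.2)) (x, y) (1, 0) (0, 1)) x := by
    simp only [hg.partialSnd_eq]
    have h := hd.comp_hasDerivAt x ((hasDerivAt_id x).prodMk (hasDerivAt_const x y))
    simpa using h.clm_apply (hasDerivAt_const x ((0, 1) : ℝ × ℝ))
  have hsymm : IsSymmSndFDerivAt ℝ (fun q : ℝ × ℝ => g q.1 q.2) (x, y) :=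
    (ContDiff.contDiffAt hg).isSymmSndFDerivAt (by
      rw [minSmoothness_of_isRCLikeNormedField]
      exact WithTop.coe_le_coe.mpr le_top)
  exact hy.deriv.trans ((hsymm _ _).trans hx.deriv.symm)

theorem integral_partialFst (hg : SmoothTwo g) (a b y : ℝ) :
    (∫ x in a..b, partialFst g x y) = g b y - g a y :=
  intervalIntegral.integral_eq_sub_of_hasDerivAt (fun x _ => hg.hasDerivAt_fst x y)
    (hg.fst.intervalIntegrable_fst a b y)

theorem integral_partialSnd (hg : SmoothTwo g) (x a b : ℝ) :
    (∫ y in a..b, partialSnd g x y) = g x b - g x a :=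
  intervalIntegral.integral_eq_sub_of_hasDerivAt (fun y _ => hg.hasDerivAt_snd x y)
    (hg.snd.intervalIntegrable_snd a b x)

theorem integral_integral_swap (hg : SmoothTwo g) (a b c d : ℝ) :
    (∫ x in a..b, ∫ y in c..d, g x y) = ∫ y in c..d, ∫ x in a..b, g x y :=
  intervalIntegral_intervalIntegral_swap <|
    (hg.continuous.continuousOn.integrableOn_compact
      (isCompact_uIcc.prod isCompact_uIcc)).mono_set
      (Set.prod_mono Set.uIoc_subset_uIcc Set.uIoc_subset_uIcc)

theorem integral_partialFst_eq_zero (hg : SmoothTwo g)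
    (hper : ∀ x y, g (x + 2 * π) y = g x y) (y : ℝ) :
    (∫ x in (-π)..π, partialFst g x y) = 0 := by
  rw [hg.integral_partialFst, sub_eq_zero, ← hper (-π) y]
  ring_nf

/-- If the average of `∂₂²g` over a period of the first variable vanishes, then so does that of
`∂₂g`, provided `g` is periodic in the second variable. -/
theorem integral_partialSnd_eq_zero (hg : SmoothTwo g)
    (hper : ∀ x y, g x (y + 2 * π) = g x y) {a b : ℝ}
    (hzero : ∀ y, (∫ x in a..b, partialSnd (partialSnd g) x y) = 0) (y : ℝ) :
    (∫ x in a..b, partialSnd g x y) = 0 := by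
  have hconst (z : ℝ) : (∫ x in a..b, partialSnd g x z) = ∫ x in a..b, partialSnd g x y := by
    have h := hg.snd.snd.integral_integral_swap a b y z
    simp only [hzero, intervalIntegral.integral_zero, hg.snd.integral_partialSnd] at h
    rw [intervalIntegral.integral_sub (hg.snd.intervalIntegrable_fst a b z)
      (hg.snd.intervalIntegrable_fst a b y)] at h
    exact sub_eq_zero.mp h
  have hπ (x : ℝ) : g x π - g x (-π) = 0 := by
    rw [sub_eq_zero, ← hper x (-π)]
    ring_nf
  have h := hg.snd.integral_integral_swap a b (-π) π
  simp only [hg.integral_partialSnd, hπ, hconst, intervalIntegral.integral_zero,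
    intervalIntegral.integral_const, smul_eq_mul] at h
  have hne : π - -π ≠ 0 := by linarith [pi_pos]
  exact (mul_eq_zero.mp h.symm).resolve_left hne

end SmoothTwo

theorem partialFst_periodic_fst {g : ℝ → ℝ → ℝ} {c : ℝ} (h : ∀ x y, g (x + c) y = g x y)
    (x y : ℝ) : partialFst g (x + c) y = partialFst g x y := by
  unfold partialFst
  rw [← deriv_comp_add_const]
  simp only [h]

theorem partialSnd_periodic_fst {g : ℝ → ℝ → ℝ} {c : ℝ} (h : ∀ x y, g (x + c) y = g x y)
    (x y : ℝ) : partialSnd g (x + c) y = partialSnd g x y := by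
  simp only [partialSnd, h]

/-- The linearized operator `L` of the 2D magnetic relaxation equations (γ = 0) around
`B = e₁`, given by `Lf = (1+a)² ∂₁²f + (1+a) ∇∂₁p_L − (∂₂a ∂₂p_L) e₁` where
`−Δp_L = 2 ∂₂a ∂₁f₂`, maps divergence-free fields with vanishing `x₁`-average to
divergence-free fields with vanishing `x₁`-average. -/
theorem stmt_6 (a : ℝ → ℝ) (f₁ f₂ pL Lf₁ Lf₂ : ℝ → ℝ → ℝ)
    (ha : ContDiff ℝ (⊤ : ℕ∞) a) (haper : ∀ x, a (x + 2 * π) = a x)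
    (hf₁ : ContDiff ℝ (⊤ : ℕ∞) (fun q : ℝ × ℝ => f₁ q.1 q.2))
    (hf₂ : ContDiff ℝ (⊤ : ℕ∞) (fun q : ℝ × ℝ => f₂ q.1 q.2))
    (hpLsmooth : ContDiff ℝ (⊤ : ℕ∞) (fun q : ℝ × ℝ => pL q.1 q.2))
    (hper : ∀ ψ ∈ [f₁, f₂, pL], ∀ x₁ x₂ : ℝ,
      ψ (x₁ + 2 * π) x₂ = ψ x₁ x₂ ∧ ψ x₁ (x₂ + 2 * π) = ψ x₁ x₂)
    (hdiv : ∀ x₁ x₂ : ℝ, deriv (fun y => f₁ y x₂) x₁ + deriv (fun y => f₂ x₁ y) x₂ = 0)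
    (hmean : ∀ x₂ : ℝ, (∫ x₁ in (-π)..π, f₁ x₁ x₂) = 0 ∧ (∫ x₁ in (-π)..π, f₂ x₁ x₂) = 0)
    (hpLavg : (∫ x₂ in (-π)..π, ∫ x₁ in (-π)..π, pL x₁ x₂) = 0)
    (hpLeq : ∀ x₁ x₂ : ℝ,
      -(deriv (deriv (fun y => pL y x₂)) x₁ + deriv (deriv (fun y => pL x₁ y)) x₂)
        = 2 * deriv a x₂ * deriv (fun y => f₂ y x₂) x₁)
    (hLf₁ : ∀ x₁ x₂ : ℝ, Lf₁ x₁ x₂ =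
      (1 + a x₂) ^ 2 * deriv (deriv (fun y => f₁ y x₂)) x₁
        + (1 + a x₂) * deriv (deriv (fun y => pL y x₂)) x₁
        - deriv a x₂ * deriv (fun y => pL x₁ y) x₂)
    (hLf₂ : ∀ x₁ x₂ : ℝ, Lf₂ x₁ x₂ =
      (1 + a x₂) ^ 2 * deriv (deriv (fun y => f₂ y x₂)) x₁
        + (1 + a x₂) * deriv (fun y₂ => deriv (fun z => pL z y₂) x₁) x₂) :
    (∀ x₁ x₂ : ℝ, deriv (fun y => Lf₁ y x₂) x₁ + deriv (fun y => Lf₂ x₁ y) x₂ = 0) ∧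
    (∀ x₂ : ℝ, (∫ x₁ in (-π)..π, Lf₁ x₁ x₂) = 0 ∧ (∫ x₁ in (-π)..π, Lf₂ x₁ x₂) = 0) := by
  have hf₁s : SmoothTwo f₁ := hf₁
  have hf₂s : SmoothTwo f₂ := hf₂
  have hps : SmoothTwo pL := hpLsmooth
  have hf₁per (x y : ℝ) : f₁ (x + 2 * π) y = f₁ x y := (hper f₁ (by simp) x y).1
  have hf₂per (x y : ℝ) : f₂ (x + 2 * π) y = f₂ x y := (hper f₂ (by simp) x y).1
  have hpper₁ (x y : ℝ) : pL (x + 2 * π) y = pL x y := (hper pL (by simp) x y).1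
  have hpper₂ (x y : ℝ) : pL x (y + 2 * π) = pL x y := (hper pL (by simp) x y).2
  have hda (y : ℝ) : HasDerivAt a (deriv a y) y :=
    (ha.differentiable (by simp) y).hasDerivAt
  replace hdiv (x y : ℝ) : partialFst f₁ x y = -partialSnd f₂ x y :=
    eq_neg_of_add_eq_zero_left (hdiv x y)
  replace hpLeq (x y : ℝ) : partialFst (partialFst pL) x y =
      -partialSnd (partialSnd pL) x y - 2 * deriv a y * partialFst f₂ x y := by
    have h : -(partialFst (partialFst pL) x y + partialSnd (partialSnd pL) x y) =
      2 * deriv a y * partialFst f₂ x y := hpLeq x y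
    linarith
  replace hLf₁ (x y : ℝ) : Lf₁ x y = (1 + a y) ^ 2 * partialFst (partialFst f₁) x y
      + (1 + a y) * partialFst (partialFst pL) x y - deriv a y * partialSnd pL x y := hLf₁ x y
  replace hLf₂ (x y : ℝ) : Lf₂ x y = (1 + a y) ^ 2 * partialFst (partialFst f₂) x y
      + (1 + a y) * partialFst (partialSnd pL) x y :=
    (hLf₂ x y).trans (by rw [← hps.partialSnd_partialFst]; rfl)
  refine ⟨fun x y => ?_, fun y => ⟨?_, ?_⟩⟩
  · have h₁ := (((hf₁s.fst.fst.hasDerivAt_fst x y).const_mul ((1 + a y) ^ 2)).add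
      ((hps.fst.fst.hasDerivAt_fst x y).const_mul (1 + a y))).sub
      ((hps.snd.hasDerivAt_fst x y).const_mul (deriv a y))
    have h₂ := ((((hda y).const_add 1).pow 2).mul (hf₂s.fst.fst.hasDerivAt_snd x y)).add
      (((hda y).const_add 1).mul (hps.snd.fst.hasDerivAt_snd x y))
    have hL₁ := (h₁.congr_of_eventuallyEq (f₁ := fun t => Lf₁ t y)
      (.of_forall fun t => hLf₁ t y)).deriv
    have hL₂ := (h₂.congr_of_eventuallyEq (f₁ := fun t => Lf₂ x t)
      (.of_forall fun t => hLf₂ x t)).deriv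
    have hf₁₁₁ : partialFst (partialFst (partialFst f₁)) x y =
        -partialSnd (partialFst (partialFst f₂)) x y := by
      have h₀ : partialFst f₁ = fun x y => -partialSnd f₂ x y := funext₂ hdiv
      have h₁ : partialFst (partialFst f₁) = fun x y => -partialFst (partialSnd f₂) x y := by
        rw [h₀]
        exact funext₂ fun x y => (hf₂s.snd.hasDerivAt_fst x y).neg.deriv
      rw [hf₂s.fst.partialSnd_partialFst, h₁,
        show partialSnd (partialFst f₂) = partialFst (partialSnd f₂) from
          funext₂ hf₂s.partialSnd_partialFst]
      exact (hf₂s.snd.fst.hasDerivAt_fst x y).neg.deriv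
    have hp₁₁₁ : partialFst (partialFst (partialFst pL)) x y =
        -partialSnd (partialFst (partialSnd pL)) x y
          - 2 * deriv a y * partialFst (partialFst f₂) x y := by
      rw [hps.snd.partialSnd_partialFst, show partialFst (partialFst pL) = _ from funext₂ hpLeq]
      exact ((hps.snd.snd.hasDerivAt_fst x y).neg.sub
        ((hf₂s.fst.hasDerivAt_fst x y).const_mul (2 * deriv a y))).deriv
    rw [hL₁, hL₂, hf₁₁₁, hp₁₁₁]
    simp only [Pi.pow_apply]
    push_cast
    ring
  · have hp₁₁ : ∀ y, (∫ x in (-π)..π, partialFst (partialFst pL) x y) = 0 :=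
      hps.fst.integral_partialFst_eq_zero (partialFst_periodic_fst hpper₁)
    have hp₂₂ (y : ℝ) : (∫ x in (-π)..π, partialSnd (partialSnd pL) x y) = 0 := by
      have h (x : ℝ) : partialSnd (partialSnd pL) x y =
          -(2 * deriv a y) * partialFst f₂ x y - partialFst (partialFst pL) x y := by
        rw [hpLeq]
        ring
      simp only [h]
      rw [intervalIntegral.integral_sub ((hf₂s.fst.intervalIntegrable_fst _ _ y).const_mul _)
        (hps.fst.fst.intervalIntegrable_fst _ _ y), intervalIntegral.integral_const_mul,
        hf₂s.integral_partialFst_eq_zero hf₂per, hp₁₁]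
      ring
    simp only [hLf₁]
    rw [intervalIntegral.integral_sub
      (((hf₁s.fst.fst.intervalIntegrable_fst _ _ y).const_mul _).add
        ((hps.fst.fst.intervalIntegrable_fst _ _ y).const_mul _))
      ((hps.snd.intervalIntegrable_fst _ _ y).const_mul _),
      intervalIntegral.integral_add ((hf₁s.fst.fst.intervalIntegrable_fst _ _ y).const_mul _)
        ((hps.fst.fst.intervalIntegrable_fst _ _ y).const_mul _)]
    simp only [intervalIntegral.integral_const_mul, hp₁₁,
      hf₁s.fst.integral_partialFst_eq_zero (partialFst_periodic_fst hf₁per),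
      hps.integral_partialSnd_eq_zero hpper₂ hp₂₂]
    ring
  · simp only [hLf₂]
    rw [intervalIntegral.integral_add ((hf₂s.fst.fst.intervalIntegrable_fst _ _ y).const_mul _)
      ((hps.snd.fst.intervalIntegrable_fst _ _ y).const_mul _)]
    simp only [intervalIntegral.integral_const_mul,
      hf₂s.fst.integral_partialFst_eq_zero (partialFst_periodic_fst hf₂per),
      hps.snd.integral_partialFst_eq_zero (partialSnd_periodic_fst hpper₁)]
    ring
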